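/- Let K be a field, n ≥ 2, and R = K[x_{ij}, y_{ij} : 1 ≤ i, j ≤ n], with f_{ij} = Σ_{k=1}^{n} x_{ik} y_{kj} the entries of the product of the n×n generic matrices, and k_t = 1 + (⌊n/t⌋ − 1)·t for 1 ≤ t ≤ n. Then the ordered sequence F̃ obtained by concatenating, for t = 1, the polynomials f_{11}, …, f_{n1}, and for each t = 2, …, n, the indeterminates y_{1t}, …, y_{(t−1)t} followed by the polynomials f_{it} for i ≡ 1 (mod t) with 1 ≤ i ≤ k_t (interleaved as y_{1t}, f_{1t}, y_{(1+t)t} together with the needed y's before each f, as in y_{12}, f_{12}, y_{32}, f_{32}, …, y_{k_2 2}, f_{k_2 2}; y_{13}, y_{23}, f_{13}, …; …; y_{1n}, …, y_{(n−1)n}, f_{1n}), is a regular sequence in R. -/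

import Mathlib

open MvPolynomial

/-- Auxiliary arithmetic bound: if `j < n / t` and `s < t` then `j * t + s < n`. -/
lemma mul_add_lt_of_lt_div {n t j s : ℕ} (hj : j < n / t) (hs : s < t) :
    j * t + s < n :=
  lt_of_lt_of_le
    (lt_of_lt_of_le (by rw [Nat.succ_mul]; omega)
      (Nat.mul_le_mul_right t (Nat.succ_le_of_lt hj)))
    (Nat.div_mul_le_self n t)

section Filtration

variable {R : Type*} [CommRing R]

/-- `φ` expands an element into its graded components: `coeff d (φ g)` is the degree `d` part. -/
structure IsGradingMap (φ : R →+* Polynomial R) : Prop where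
  inj : Function.Injective φ
  coeff_map : ∀ b c, φ ((φ b).coeff c) = Polynomial.monomial c ((φ b).coeff c)

/-- Leading forms of elements of `I` lie in `J`. -/
def LeadIn (φ : R →+* Polynomial R) (I J : Ideal R) : Prop :=
  ∀ d : ℕ, ∀ g ∈ I, (φ g).natDegree ≤ d → (φ g).coeff d ∈ J

/-- Components of elements of `J` lift to elements of `I` as leading forms. -/
def LeadLift (φ : R →+* Polynomial R) (I J : Ideal R) : Prop :=
  ∀ d : ℕ, ∀ a ∈ J, ∃ u ∈ I, (φ u).natDegree ≤ d ∧ (φ u).coeff d = (φ a).coeff d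

variable {φ : R →+* Polynomial R}

lemma IsGradingMap.coeff_coeff (h : IsGradingMap φ) (b : R) (c : ℕ) :
    (φ ((φ b).coeff c)).coeff c = (φ b).coeff c := by
  rw [h.coeff_map, Polynomial.coeff_monomial, if_pos rfl]

/-- Replace `q` by `q - u` where `u ∈ I` has the same leading form. -/
lemma exists_reduce (hφ : IsGradingMap φ) {I J : Ideal R} (hQ : LeadLift φ I J) {q : R} {k : ℕ}
    (hq : ∀ c, k + 1 ≤ c → (φ q).coeff c = 0) (hJ : (φ q).coeff k ∈ J) :
    ∃ u ∈ I, ∀ c, k ≤ c → (φ (q - u)).coeff c = 0 := by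
  obtain ⟨u, hu, hdeg, hco⟩ := hQ k _ hJ
  refine ⟨u, hu, fun c hc => ?_⟩
  rw [hφ.coeff_coeff] at hco
  rw [map_sub, Polynomial.coeff_sub]
  rcases hc.eq_or_lt with rfl | hlt
  · rw [hco, sub_self]
  · rw [hq c hlt, Polynomial.coeff_eq_zero_of_natDegree_lt (lt_of_le_of_lt hdeg hlt), sub_zero]

lemma natDegree_le_of_coeff {q : Polynomial R} {k : ℕ} (hq : ∀ c, k + 1 ≤ c → q.coeff c = 0) :
    q.natDegree ≤ k :=
  Polynomial.natDegree_le_iff_coeff_eq_zero.2 fun N hN => hq N hN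

lemma eq_zero_of_coeff (hφ : IsGradingMap φ) {q : R} (hq : ∀ c, 0 ≤ c → (φ q).coeff c = 0) :
    q = 0 := by
  apply hφ.inj
  rw [map_zero]
  ext1 c
  rw [hq c (Nat.zero_le c), Polynomial.coeff_zero]

lemma nzd_step (hφ : IsGradingMap φ) {I J : Ideal R} (hP : LeadIn φ I J) (hQ : LeadLift φ I J)
    {p : R} {e : ℕ} (hp : (φ p).natDegree ≤ e)
    (hm : ∀ x, (φ p).coeff e * x ∈ J → x ∈ J) (g : R) (hg : p * g ∈ I) : g ∈ I := by
  have key : ∀ k : ℕ, ∀ g : R, (∀ c, k ≤ c → (φ g).coeff c = 0) → p * g ∈ I → g ∈ I := by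
    intro k
    induction k with
    | zero =>
      intro g hg _
      rw [eq_zero_of_coeff hφ hg]
      exact I.zero_mem
    | succ k ih =>
      intro g hg hpg
      have hd := natDegree_le_of_coeff hg
      have h1 : (φ (p * g)).natDegree ≤ e + k := by
        rw [map_mul]
        exact Polynomial.natDegree_mul_le_of_le hp hd
      have h2 := hP _ _ hpg h1
      rw [map_mul, Polynomial.coeff_mul_add_eq_of_natDegree_le hp hd] at h2
      obtain ⟨u, hu, hc⟩ := exists_reduce hφ hQ hg (hm _ h2)
      have h3 := ih _ hc (by rw [mul_sub]; exact I.sub_mem hpg (I.mul_mem_left _ hu))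
      have := I.add_mem h3 hu
      rwa [sub_add_cancel] at this
  exact key ((φ g).natDegree + 1) g
    (fun c hc => Polynomial.coeff_eq_zero_of_natDegree_lt hc) hg

lemma leadIn_step (hφ : IsGradingMap φ) {I J : Ideal R} (hP : LeadIn φ I J) (hQ : LeadLift φ I J)
    {p : R} {e : ℕ} (hp : (φ p).natDegree ≤ e)
    (hm : ∀ x, (φ p).coeff e * x ∈ J → x ∈ J) :
    LeadIn φ (I ⊔ Ideal.span {p}) (J ⊔ Ideal.span {(φ p).coeff e}) := by
  have key : ∀ k : ℕ, ∀ q h : R, (∀ c, k ≤ c → (φ q).coeff c = 0) → h ∈ I →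
      ∀ d, (φ (h + p * q)).natDegree ≤ d →
        (φ (h + p * q)).coeff d ∈ J ⊔ Ideal.span {(φ p).coeff e} := by
    intro k
    induction k with
    | zero =>
      intro q h hq hh d hd
      rw [eq_zero_of_coeff hφ hq, mul_zero, add_zero] at hd ⊢
      exact Ideal.mem_sup_left (hP d h hh hd)
    | succ k ih =>
      intro q h hq hh d hd
      have hqd := natDegree_le_of_coeff hq
      have h1 : (φ (p * q)).natDegree ≤ e + k := by
        rw [map_mul]
        exact Polynomial.natDegree_mul_le_of_le hp hqd
      have hco : (φ (p * q)).coeff (e + k) = (φ p).coeff e * (φ q).coeff k := by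
        rw [map_mul, Polynomial.coeff_mul_add_eq_of_natDegree_le hp hqd]
      have hh' : h = (h + p * q) - p * q := by ring
      by_cases hle : e + k ≤ d
      · have hhd : (φ h).natDegree ≤ d := by
          rw [hh', map_sub]
          exact Polynomial.natDegree_sub_le_of_le hd (h1.trans hle) |>.trans (by simp)
        rw [map_add, Polynomial.coeff_add]
        refine add_mem (Ideal.mem_sup_left (hP d h hh hhd)) (Ideal.mem_sup_right ?_)
        rcases hle.eq_or_lt with rfl | hlt
        · rw [hco]
          exact Ideal.mul_mem_right _ _ (Ideal.mem_span_singleton_self _)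
        · rw [Polynomial.coeff_eq_zero_of_natDegree_lt (lt_of_le_of_lt h1 hlt)]
          exact zero_mem _
      · have hlt : d < e + k := not_le.1 hle
        have hhd : (φ h).natDegree ≤ e + k := by
          rw [hh', map_sub]
          exact Polynomial.natDegree_sub_le_of_le (hd.trans hlt.le) h1 |>.trans (by simp)
        have h2 := hP _ _ hh hhd
        have h3 : (φ h).coeff (e + k) = -((φ p).coeff e * (φ q).coeff k) := by
          rw [← hco]
          nth_rewrite 1 [hh']
          rw [map_sub, Polynomial.coeff_sub,
            Polynomial.coeff_eq_zero_of_natDegree_lt (lt_of_le_of_lt hd hlt), zero_sub]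
        rw [h3, neg_mem_iff] at h2
        obtain ⟨u, hu, hc⟩ := exists_reduce hφ hQ hq (hm _ h2)
        have hrw : h + p * q = (h + p * u) + p * (q - u) := by ring
        rw [hrw] at hd ⊢
        exact ih _ _ hc (I.add_mem hh (I.mul_mem_left _ hu)) d hd
  intro d g hg hd
  obtain ⟨h, hh, y, hy, rfl⟩ := Submodule.mem_sup.1 hg
  obtain ⟨q, rfl⟩ := Ideal.mem_span_singleton'.1 hy
  rw [mul_comm q p] at hd ⊢
  exact key ((φ q).natDegree + 1) q h
    (fun c hc => Polynomial.coeff_eq_zero_of_natDegree_lt hc) hh d hd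

lemma leadLift_step (hφ : IsGradingMap φ) {I J : Ideal R} (hQ : LeadLift φ I J)
    {p : R} {e : ℕ} (hp : (φ p).natDegree ≤ e) :
    LeadLift φ (I ⊔ Ideal.span {p}) (J ⊔ Ideal.span {(φ p).coeff e}) := by
  intro d a ha
  obtain ⟨h, hh, y, hy, rfl⟩ := Submodule.mem_sup.1 ha
  obtain ⟨b, rfl⟩ := Ideal.mem_span_singleton'.1 hy
  obtain ⟨u, hu, hud, huc⟩ := hQ d h hh
  by_cases hle : e ≤ d
  · obtain ⟨c, rfl⟩ := Nat.exists_eq_add_of_le' hle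
    refine ⟨u + (φ b).coeff c * p, add_mem (Ideal.mem_sup_left hu) (Ideal.mem_sup_right
      (Ideal.mul_mem_left _ _ (Ideal.mem_span_singleton_self p))), ?_, ?_⟩
    · rw [map_add, map_mul, hφ.coeff_map]
      exact Polynomial.natDegree_add_le_of_le hud
        (Polynomial.natDegree_mul_le_of_le (Polynomial.natDegree_monomial_le _) hp)
        |>.trans (by simp)
    · rw [map_add, map_mul, Polynomial.coeff_add, huc, map_add, Polynomial.coeff_add, hφ.coeff_map,
        map_mul, hφ.coeff_map, Polynomial.coeff_mul_add_eq_of_natDegree_le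
          (Polynomial.natDegree_monomial_le _) hp, Polynomial.coeff_monomial, if_pos rfl,
        Polynomial.coeff_mul_monomial]
  · refine ⟨u, Ideal.mem_sup_left hu, hud, ?_⟩
    rw [huc, map_add, map_mul, hφ.coeff_map, Polynomial.coeff_add,
      ← Polynomial.C_mul_X_pow_eq_monomial, ← mul_assoc, Polynomial.coeff_mul_X_pow', if_neg hle,
      add_zero]

end Filtration

section Monomials

variable {K σ : Type*} [Field K]

/-- exponent of the squarefree monomial with support `S` -/
noncomputable def sqf (S : Finset σ) : σ →₀ ℕ := Finsupp.indicator S fun _ _ => 1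

lemma sqf_apply [DecidableEq σ] (S : Finset σ) (v : σ) : sqf S v = if v ∈ S then 1 else 0 := by
  simp [sqf, Finsupp.indicator_apply]

lemma sqf_nzd {L : Set (Finset σ)} {S : Finset σ} (h : ∀ T ∈ L, Disjoint T S)
    (x : MvPolynomial σ K)
    (hx : monomial (sqf S) (1 : K) * x ∈ Ideal.span ((fun s => monomial s (1 : K)) '' (sqf '' L))) :
    x ∈ Ideal.span ((fun s => monomial s (1 : K)) '' (sqf '' L)) := by
  classical
  rw [mem_ideal_span_monomial_image] at hx ⊢
  intro xi hxi
  obtain ⟨_, ⟨T, hT, rfl⟩, hle⟩ := hx (sqf S + xi) (by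
    rw [mem_support_iff, coeff_monomial_mul, one_mul]
    exact mem_support_iff.1 hxi)
  refine ⟨_, ⟨T, hT, rfl⟩, fun v => ?_⟩
  have h1 := hle v
  rw [Finsupp.add_apply, sqf_apply, sqf_apply] at h1
  rw [sqf_apply]
  by_cases hv : v ∈ T
  · have := Finset.disjoint_left.1 (h T hT) hv
    simpa [hv, this] using h1
  · simp [hv]

/-- the grading homomorphism for the weights `w` -/
noncomputable def gmap (K : Type*) [Field K] (w : σ → ℕ) :
    MvPolynomial σ K →+* Polynomial (MvPolynomial σ K) :=
  eval₂Hom (Polynomial.C.comp MvPolynomial.C)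
    (fun v => Polynomial.C (MvPolynomial.X v) * Polynomial.X ^ (w v))

lemma gmap_X (w : σ → ℕ) (v : σ) : gmap K w (X v) = Polynomial.C (X v) * Polynomial.X ^ (w v) := by
  simp [gmap]

lemma gmap_C (w : σ → ℕ) (a : K) : gmap K w (C a) = Polynomial.C (C a) := by
  simp [gmap]

lemma gmap_grading (w : σ → ℕ) : IsGradingMap (gmap K w) where
  inj := by
    have : ((Polynomial.evalRingHom (1 : MvPolynomial σ K)).comp (gmap K w)) = RingHom.id _ := by
      apply MvPolynomial.ringHom_ext
      · intro a; simp [gmap_C]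
      · intro v; simp [gmap_X]
    intro a b hab
    have h1 := congrArg (Polynomial.evalRingHom (1 : MvPolynomial σ K)) hab
    rwa [← RingHom.comp_apply, ← RingHom.comp_apply, this] at h1
  coeff_map := by
    intro b
    induction b using MvPolynomial.induction_on with
    | C a =>
      intro c
      rw [gmap_C, Polynomial.coeff_C]
      split_ifs with h
      · rw [gmap_C, h]; rfl
      · simp
    | add p q hp hq =>
      intro c
      rw [map_add, Polynomial.coeff_add, map_add, hp, hq, map_add]
    | mul_X p v hp =>
      intro c
      rw [map_mul, gmap_X, ← mul_assoc, Polynomial.coeff_mul_X_pow', Polynomial.coeff_mul_C]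
      split_ifs with h
      · rw [map_mul, hp, gmap_X, ← mul_assoc, Polynomial.monomial_mul_C,
          ← Polynomial.C_mul_X_pow_eq_monomial, mul_assoc, ← pow_add, Nat.sub_add_cancel h,
          Polynomial.C_mul_X_pow_eq_monomial]
      · simp

/-- `p` has leading form the squarefree monomial on `S`. -/
def HasLead (w : σ → ℕ) (p : MvPolynomial σ K) (S : Finset σ) : Prop :=
  ∃ e, (gmap K w p).natDegree ≤ e ∧ (gmap K w p).coeff e = monomial (sqf S) 1

lemma lead_list (w : σ → ℕ) (l : List (MvPolynomial σ K × Finset σ))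
    (hl : ∀ a ∈ l, HasLead w a.1 a.2) (hd : l.Pairwise fun a b => Disjoint a.2 b.2) :
    LeadIn (gmap K w) (Ideal.ofList (l.map Prod.fst))
      (Ideal.span ((fun s => monomial s (1 : K)) '' (sqf '' {S | S ∈ l.map Prod.snd}))) ∧
    LeadLift (gmap K w) (Ideal.ofList (l.map Prod.fst))
      (Ideal.span ((fun s => monomial s (1 : K)) '' (sqf '' {S | S ∈ l.map Prod.snd}))) := by
  induction l using List.reverseRecOn with
  | nil =>
    constructor
    · intro d g hg _
      have : g = 0 := by simpa using hg
      simp [this]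
    · intro d a ha
      have : a = 0 := by simpa using ha
      exact ⟨0, zero_mem _, by simp, by simp [this]⟩
  | append_singleton l a ih =>
    rw [List.pairwise_append] at hd
    obtain ⟨hP, hQ⟩ := ih (fun b hb => hl b (by simp [hb])) hd.1
    obtain ⟨e, he, hc⟩ := hl a (by simp)
    have hset : Ideal.span ((fun s => monomial s (1 : K)) ''
        (sqf '' {S | S ∈ (l ++ [a]).map Prod.snd})) =
        Ideal.span ((fun s => monomial s (1 : K)) '' (sqf '' {S | S ∈ l.map Prod.snd})) ⊔
          Ideal.span {(gmap K w a.1).coeff e} := by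
      rw [hc, ← Ideal.span_union]
      congr 1
      have : {S | S ∈ (l ++ [a]).map Prod.snd} = {S | S ∈ l.map Prod.snd} ∪ {a.2} := by
        ext S
        simp [or_comm]
      rw [this, Set.image_union, Set.image_union, Set.image_singleton, Set.image_singleton]
    have hm : ∀ x, (gmap K w a.1).coeff e * x ∈
        Ideal.span ((fun s => monomial s (1 : K)) '' (sqf '' {S | S ∈ l.map Prod.snd})) →
        x ∈ Ideal.span ((fun s => monomial s (1 : K)) '' (sqf '' {S | S ∈ l.map Prod.snd})) := by
      intro x hx
      rw [hc] at hx
      refine sqf_nzd ?_ x hx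
      intro T hT
      obtain ⟨b, hb, rfl⟩ := List.mem_map.1 hT
      exact hd.2.2 b hb a (by simp)
    rw [hset, List.map_append, Ideal.ofList_append, List.map_singleton, Ideal.ofList_singleton]
    exact ⟨leadIn_step (gmap_grading w) hP hQ he hm, leadLift_step (gmap_grading w) hQ he⟩

theorem isWeaklyRegular_of_lead (w : σ → ℕ) (l : List (MvPolynomial σ K × Finset σ))
    (hl : ∀ a ∈ l, HasLead w a.1 a.2) (hd : l.Pairwise fun a b => Disjoint a.2 b.2) :
    RingTheory.Sequence.IsWeaklyRegular (MvPolynomial σ K) (l.map Prod.fst) := by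
  constructor
  intro i hi
  have hi' : i < l.length := by simpa using hi
  rw [smul_eq_mul, Ideal.mul_top, isSMulRegular_quotient_iff_mem_of_smul_mem]
  intro x hx
  rw [← List.map_take] at hx ⊢
  obtain ⟨hP, hQ⟩ := lead_list w (l.take i) (fun a ha => hl a (List.mem_of_mem_take ha))
    (hd.sublist (List.take_sublist i l))
  obtain ⟨e, he, hc⟩ := hl l[i] (List.getElem_mem hi')
  rw [List.getElem_map, smul_eq_mul] at hx
  refine nzd_step (gmap_grading w) hP hQ he ?_ x hx
  intro x hx
  rw [hc] at hx
  refine sqf_nzd ?_ x hx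
  intro T hT
  obtain ⟨b, hb, rfl⟩ := List.mem_map.1 hT
  obtain ⟨j, hj, rfl⟩ := List.mem_take_iff_getElem.1 hb
  exact List.pairwise_iff_getElem.1 hd j i _ hi' (by omega)

end Monomials

section Weights

variable {K : Type*} [Field K] {n : ℕ}

/-- The weights: `w(x_{ik}) = n² - k² + 2ik`, `w(y_{kt}) = 2kt` (indices from zero). -/
def wt (n : ℕ) : (Fin n × Fin n) ⊕ (Fin n × Fin n) → ℕ
  | Sum.inl (i, k) => (n * n - k.1 * k.1) + 2 * i.1 * k.1
  | Sum.inr (k, t) => 2 * k.1 * t.1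

lemma wt_eq (i k t : Fin n) :
    ((wt n (Sum.inl (i, k)) + wt n (Sum.inr (k, t)) : ℕ) : ℤ) =
      n * n + (i.1 + t.1) ^ 2 - (k.1 - (i.1 + t.1)) ^ 2 := by
  have h : k.1 * k.1 ≤ n * n := Nat.mul_le_mul k.2.le k.2.le
  simp only [wt]
  push_cast [Nat.cast_sub h]
  ring

lemma wt_le (i k k' t : Fin n) (hk : k.1 = i.1 + t.1) :
    wt n (Sum.inl (i, k')) + wt n (Sum.inr (k', t)) ≤
      wt n (Sum.inl (i, k)) + wt n (Sum.inr (k, t)) := by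
  have h1 := wt_eq i k t
  have h2 := wt_eq i k' t
  have h3 : (k.1 : ℤ) - (i.1 + t.1) = 0 := by rw [hk]; push_cast; ring
  rw [h3] at h1
  zify at *
  nlinarith [sq_nonneg ((k'.1 : ℤ) - (i.1 + t.1))]

lemma wt_inj (i k k' t : Fin n) (hk : k.1 = i.1 + t.1)
    (h : wt n (Sum.inl (i, k)) + wt n (Sum.inr (k, t)) =
      wt n (Sum.inl (i, k')) + wt n (Sum.inr (k', t))) : k' = k := by
  have h1 := wt_eq i k t
  have h2 := wt_eq i k' t
  have h3 : (k.1 : ℤ) - (i.1 + t.1) = 0 := by rw [hk]; push_cast; ring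
  rw [h3] at h1
  rw [← h, h1] at h2
  have h4 : ((k'.1 : ℤ) - (i.1 + t.1)) ^ 2 = 0 := by linarith
  have h5 := pow_eq_zero_iff (two_ne_zero) |>.1 h4
  apply Fin.ext
  omega

lemma hasLead_f (i k t : Fin n) (hk : k.1 = i.1 + t.1) :
    HasLead (K := K) (wt n) (∑ k, X (Sum.inl (i, k)) * X (Sum.inr (k, t)))
      {Sum.inl (i, k), Sum.inr (k, t)} := by
  classical
  have hφ : gmap K (wt n) (∑ k, X (Sum.inl (i, k)) * X (Sum.inr (k, t))) =
      ∑ k, Polynomial.monomial (wt n (Sum.inl (i, k)) + wt n (Sum.inr (k, t)))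
        (X (Sum.inl (i, k)) * X (Sum.inr (k, t))) := by
    rw [map_sum]
    refine Finset.sum_congr rfl fun k _ => ?_
    rw [map_mul, gmap_X, gmap_X, ← Polynomial.C_mul_X_pow_eq_monomial, Polynomial.C_mul, pow_add]
    ring
  refine ⟨wt n (Sum.inl (i, k)) + wt n (Sum.inr (k, t)), ?_, ?_⟩
  · rw [hφ]
    exact Polynomial.natDegree_sum_le_of_forall_le _ _ fun k' _ =>
      (Polynomial.natDegree_monomial_le _).trans (wt_le i k k' t hk)
  · rw [hφ, Polynomial.finsetSum_coeff, Finset.sum_eq_single k]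
    · rw [Polynomial.coeff_monomial, if_pos rfl]
      have : sqf {Sum.inl (i, k), Sum.inr (k, t)} =
          Finsupp.single (Sum.inl (i, k)) 1 + Finsupp.single (Sum.inr (k, t)) 1 := by
        ext v
        rw [sqf_apply, Finsupp.add_apply, Finsupp.single_apply, Finsupp.single_apply]
        rcases v with v | v <;> simp [eq_comm]
      rw [this, X, X, monomial_mul, one_mul]
    · intro k' _ hne
      rw [Polynomial.coeff_monomial, if_neg]
      intro h
      exact hne (wt_inj i k k' t hk h.symm)
    · simp

lemma hasLead_X {σ : Type*} (w : σ → ℕ) (v : σ) : HasLead (K := K) w (X v) {v} := by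
  classical
  refine ⟨w v, ?_, ?_⟩
  · rw [gmap_X]
    exact Polynomial.natDegree_C_mul_X_pow_le _ _
  · rw [gmap_X, Polynomial.coeff_C_mul_X_pow, if_pos rfl]
    have : sqf {v} = Finsupp.single v 1 := by
      ext u
      rw [sqf_apply, Finsupp.single_apply]
      simp [eq_comm]
    rw [this, X]

end Weights

/-- In `R = K[xᵢⱼ, yᵢⱼ : 1 ≤ i,j ≤ n]`, `n ≥ 2` (variables indexed by
`(Fin n × Fin n) ⊕ (Fin n × Fin n)`, the left summand for the `x`'s and the right one
for the `y`'s), with `f i j = Σₖ x i k * y k j` the entries of the product of the two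
generic matrices and `k_t = 1 + (⌊n/t⌋ − 1)·t`, the augmented ordered sequence
`F̃ = f₁₁, …, f_{n1};  y₁₂, f₁₂, y₃₂, f₃₂, …, y_{k₂2}, f_{k₂2};
 y₁₃, y₂₃, f₁₃, …, y_{k₃3}, y_{(k₃+1)3}, f_{k₃3};  …;  y_{1n}, …, y_{(n−1)n}, f_{1n}`
(each `f_{it}`, `i = 1 + j·t ≤ k_t`, being preceded by the indeterminates
`y_{it}, …, y_{(i+t−2)t}`) is a regular sequence in `R`. -/
theorem augmented_sequence_regularSequence
    {K : Type*} [Field K] (n : ℕ) (hn : 2 ≤ n)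
    (f : Fin n → Fin n → MvPolynomial ((Fin n × Fin n) ⊕ (Fin n × Fin n)) K)
    (hf : ∀ i j, f i j = ∑ k, X (Sum.inl (i, k)) * X (Sum.inr (k, j))) :
    RingTheory.Sequence.IsRegular (MvPolynomial ((Fin n × Fin n) ⊕ (Fin n × Fin n)) K)
      ((List.ofFn fun i : Fin n => f i ⟨0, by omega⟩)
        ++ (List.ofFn fun t : Fin (n - 1) =>
              (List.ofFn fun j : Fin (n / (t.1 + 2)) =>
                (List.ofFn fun s : Fin (t.1 + 1) =>
                  (X (Sum.inr
                      (⟨j.1 * (t.1 + 2) + s.1,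
                        mul_add_lt_of_lt_div j.2 (by omega)⟩,
                       ⟨t.1 + 1, by omega⟩)) :
                    MvPolynomial ((Fin n × Fin n) ⊕ (Fin n × Fin n)) K))
                ++ [f ⟨j.1 * (t.1 + 2), by
                        simpa using mul_add_lt_of_lt_div j.2 (Nat.succ_pos (t.1 + 1))⟩
                      ⟨t.1 + 1, by omega⟩]).flatten).flatten) := by
  classical
  let l : List (MvPolynomial ((Fin n × Fin n) ⊕ (Fin n × Fin n)) K ×
      Finset ((Fin n × Fin n) ⊕ (Fin n × Fin n))) :=
    ((List.ofFn fun i : Fin n => (f i ⟨0, by omega⟩, {Sum.inl (i, i), Sum.inr (i, ⟨0, by omega⟩)}))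
        ++ (List.ofFn fun t : Fin (n - 1) =>
              (List.ofFn fun j : Fin (n / (t.1 + 2)) =>
                (List.ofFn fun s : Fin (t.1 + 1) =>
                  (X (Sum.inr
                      (⟨j.1 * (t.1 + 2) + s.1,
                        mul_add_lt_of_lt_div j.2 (by omega)⟩,
                       ⟨t.1 + 1, by omega⟩)),
                    {Sum.inr
                      (⟨j.1 * (t.1 + 2) + s.1,
                        mul_add_lt_of_lt_div j.2 (by omega)⟩,
                       ⟨t.1 + 1, by omega⟩)}))
                ++ [(f ⟨j.1 * (t.1 + 2), by
                        simpa using mul_add_lt_of_lt_div j.2 (Nat.succ_pos (t.1 + 1))⟩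
                      ⟨t.1 + 1, by omega⟩,
                    {Sum.inl (⟨j.1 * (t.1 + 2), by
                        simpa using mul_add_lt_of_lt_div j.2 (Nat.succ_pos (t.1 + 1))⟩,
                        ⟨j.1 * (t.1 + 2) + (t.1 + 1), mul_add_lt_of_lt_div j.2 (by omega)⟩),
                     Sum.inr (⟨j.1 * (t.1 + 2) + (t.1 + 1), mul_add_lt_of_lt_div j.2 (by omega)⟩,
                        ⟨t.1 + 1, by omega⟩)})]).flatten).flatten)
  have hlead : ∀ a ∈ l, HasLead (wt n) a.1 a.2 := by
    intro a ha
    simp only [l, List.mem_append, List.mem_flatten, List.mem_ofFn, List.mem_singleton] at ha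
    rcases ha with ⟨i, rfl⟩ | ⟨_, ⟨t, rfl⟩, ha⟩
    · rw [hf]
      exact hasLead_f _ _ _ (by simp)
    · simp only [List.mem_append, List.mem_flatten, List.mem_ofFn, List.mem_singleton] at ha
      obtain ⟨_, ⟨j, rfl⟩, ha⟩ := ha
      simp only [List.mem_append, List.mem_ofFn, List.mem_singleton] at ha
      rcases ha with ⟨s, rfl⟩ | rfl
      · exact hasLead_X _ _
      · rw [hf]
        exact hasLead_f _ _ _ (by simp)
  have hmap : l.map Prod.fst = ((List.ofFn fun i : Fin n => f i ⟨0, by omega⟩)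
        ++ (List.ofFn fun t : Fin (n - 1) =>
              (List.ofFn fun j : Fin (n / (t.1 + 2)) =>
                (List.ofFn fun s : Fin (t.1 + 1) =>
                  (X (Sum.inr
                      (⟨j.1 * (t.1 + 2) + s.1,
                        mul_add_lt_of_lt_div j.2 (by omega)⟩,
                       ⟨t.1 + 1, by omega⟩)) :
                    MvPolynomial ((Fin n × Fin n) ⊕ (Fin n × Fin n)) K))
                ++ [f ⟨j.1 * (t.1 + 2), by
                        simpa using mul_add_lt_of_lt_div j.2 (Nat.succ_pos (t.1 + 1))⟩
                      ⟨t.1 + 1, by omega⟩]).flatten).flatten) := by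
    simp only [l, List.map_append, List.map_ofFn, List.map_flatten, Function.comp_def,
      List.map_cons, List.map_nil]
  have hpw : l.Pairwise fun a b => Disjoint a.2 b.2 := by
    simp only [l]
    rw [List.pairwise_append, List.pairwise_flatten, List.pairwise_ofFn, List.pairwise_ofFn]
    refine ⟨?_, ⟨?_, ?_⟩, ?_⟩
    · intro i j hij
      have := hij.ne
      simp [this, this.symm]
    · intro _ hl
      obtain ⟨t, rfl⟩ := List.mem_ofFn.1 hl
      rw [List.pairwise_flatten, List.pairwise_ofFn]
      constructor
      · intro _ hl
        obtain ⟨j, rfl⟩ := List.mem_ofFn.1 hl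
        rw [List.pairwise_append, List.pairwise_ofFn]
        refine ⟨?_, List.pairwise_singleton _ _, ?_⟩
        · intro s s' hs
          have : s.1 < s'.1 := hs
          simp
          omega
        · intro a ha b hb
          obtain ⟨s, rfl⟩ := List.mem_ofFn.1 ha
          rw [List.mem_singleton] at hb
          subst hb
          have := s.2
          simp
          omega
      · intro j j' hj a ha b hb
        have hj1 : j.1 + 1 ≤ j'.1 := hj
        have hj2 : (j.1 + 1) * (t.1 + 2) ≤ j'.1 * (t.1 + 2) := Nat.mul_le_mul_right _ hj1
        rw [Nat.succ_mul] at hj2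
        simp only [List.mem_append, List.mem_ofFn, List.mem_singleton] at ha hb
        rcases ha with ⟨s, rfl⟩ | rfl <;> rcases hb with ⟨s', rfl⟩ | rfl <;> simp <;> omega
    · intro t t' ht a ha b hb
      have ht' : t.1 < t'.1 := ht
      simp only [List.mem_flatten, List.mem_ofFn] at ha hb
      obtain ⟨_, ⟨j, rfl⟩, ha⟩ := ha
      obtain ⟨_, ⟨j', rfl⟩, hb⟩ := hb
      simp only [List.mem_append, List.mem_ofFn, List.mem_singleton] at ha hb
      rcases ha with ⟨s, rfl⟩ | rfl <;> rcases hb with ⟨s', rfl⟩ | rfl <;> simp <;> omega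
    · intro a ha b hb
      simp only [List.mem_flatten, List.mem_ofFn] at ha hb
      obtain ⟨i, rfl⟩ := ha
      obtain ⟨_, ⟨t, rfl⟩, hb⟩ := hb
      simp only [List.mem_flatten, List.mem_ofFn] at hb
      obtain ⟨_, ⟨j', rfl⟩, hb⟩ := hb
      simp only [List.mem_append, List.mem_ofFn, List.mem_singleton] at hb
      rcases hb with ⟨s', rfl⟩ | rfl
      · simp
      · simp [Fin.ext_iff]
        omega
  have hweak := isWeaklyRegular_of_lead (wt n) l hlead hpw
  rw [hmap] at hweak
  refine ⟨hweak, ?_⟩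
  rw [smul_eq_mul, Ideal.mul_top, ← hmap]
  intro htop
  have hle : Ideal.ofList (l.map Prod.fst) ≤ RingHom.ker (constantCoeff (R := K)
      (σ := (Fin n × Fin n) ⊕ (Fin n × Fin n))) := by
    rw [Ideal.ofList, Ideal.span_le]
    intro p hp
    have hf0 : ∀ i j, constantCoeff (f i j) = 0 := by
      intro i j
      rw [hf, map_sum]
      simp
    rw [hmap] at hp
    simp only [Set.mem_setOf_eq, List.mem_append, List.mem_flatten, List.mem_ofFn] at hp
    rcases hp with ⟨i, rfl⟩ | ⟨_, ⟨t, rfl⟩, ha⟩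
    · exact hf0 _ _
    · simp only [List.mem_flatten, List.mem_ofFn] at ha
      obtain ⟨_, ⟨j, rfl⟩, ha⟩ := ha
      simp only [List.mem_append, List.mem_ofFn, List.mem_singleton] at ha
      rcases ha with ⟨s, rfl⟩ | rfl
      · exact constantCoeff_X _ _
      · exact hf0 _ _
  rw [← htop] at hle
  have h1 := hle (Submodule.mem_top (x := 1))
  rw [RingHom.mem_ker, map_one] at h1
  exact one_ne_zero h1
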